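/- Let μ ≠ 0 and let α, β, γ, δ, σ be real constants with αδ − βγ = 1 and σ ≠ 0. If w is a C² solution of the (1+1)-dimensional linear heat equation with inverse square potential w_s = w_pp + μ·p^{−2}·w on the set {(s,p) ∈ ℝ² : p ≠ 0}, then the function v(t,x) := σ·|γt + δ|^{−1/2} · exp( −γx²/(4(γt + δ)) ) · w( (αt + β)/(γt + δ), x/(γt + δ) ) is a solution of the same equation v_t = v_xx + μ·x^{−2}·v on the open set {(t,x) ∈ ℝ² : γt + δ ≠ 0 and x ≠ 0}. -/

import Mathlib

/-- ∂_t v for v = v(t,x). -/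
noncomputable def hT (v : ℝ → ℝ → ℝ) (t x : ℝ) : ℝ := deriv (fun s => v s x) t
/-- ∂²_x v for v = v(t,x). -/
noncomputable def hXX (v : ℝ → ℝ → ℝ) (t x : ℝ) : ℝ := deriv (deriv (fun s => v t s)) x

/-- The transformed function of Theorem 9 of the paper. -/
noncomputable def sol17 (α β γ δ σ : ℝ) (w : ℝ → ℝ → ℝ) (t x : ℝ) : ℝ :=
  σ * |γ * t + δ| ^ (-(1 : ℝ) / 2) * Real.exp (-γ * x ^ 2 / (4 * (γ * t + δ))) *
    w ((α * t + β) / (γ * t + δ)) (x / (γ * t + δ))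

/-- The domain `{(s, p) | p ≠ 0}` of the equation is open. -/
theorem isOpen_snd_ne_zero : IsOpen {p : ℝ × ℝ | p.2 ≠ 0} :=
  isOpen_ne_fun continuous_snd continuous_const

theorem hasDerivAt_abs_affine_rpow (γ δ t r : ℝ) (h : γ * t + δ ≠ 0) :
    HasDerivAt (fun s => |γ * s + δ| ^ r)
      (r * γ / (γ * t + δ) * |γ * t + δ| ^ r) t := by
  have hlin : HasDerivAt (fun s => γ * s + δ) γ t := by
    simpa using ((hasDerivAt_id t).const_mul γ).add_const δ
  have habs := (hasDerivAt_abs h).comp t hlin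
  have hpow := habs.rpow_const (p := r) (Or.inl (abs_ne_zero.mpr h))
  refine hpow.congr_deriv ?_
  simp only [Function.comp_apply]
  rw [Real.rpow_sub_one (abs_ne_zero.mpr h)]
  rcases lt_or_gt_of_ne h with h' | h'
  · rw [sign_neg h', abs_of_neg h']
    simp only [SignType.coe_neg, SignType.coe_one]
    field_simp
  · rw [sign_pos h', abs_of_pos h']
    simp only [SignType.coe_one]
    field_simp

/-- Chain rule along a plane curve, in terms of partial derivatives. -/
theorem hasDerivAt_comp_curve {w : ℝ → ℝ → ℝ} {a b : ℝ → ℝ} {a' b' t : ℝ}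
    (hw : DifferentiableAt ℝ (fun p : ℝ × ℝ => w p.1 p.2) (a t, b t))
    (ha : HasDerivAt a a' t) (hb : HasDerivAt b b' t) :
    HasDerivAt (fun s => w (a s) (b s))
      (a' * hT w (a t) (b t) + b' * deriv (w (a t)) (b t)) t := by
  set L := fderiv ℝ (fun p : ℝ × ℝ => w p.1 p.2) (a t, b t) with hL
  have hF : HasFDerivAt (fun p : ℝ × ℝ => w p.1 p.2) L (a t, b t) := hw.hasFDerivAt
  have hfst : hT w (a t) (b t) = L (1, 0) :=
    (hF.comp_hasDerivAt (f := fun s => (s, b t)) (a t)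
      ((hasDerivAt_id (a t)).prodMk (hasDerivAt_const (a t) (b t)))).deriv
  have hsnd : deriv (w (a t)) (b t) = L (0, 1) :=
    (hF.comp_hasDerivAt (f := fun s => (a t, s)) (b t)
      ((hasDerivAt_const (b t) (a t)).prodMk (hasDerivAt_id (b t)))).deriv
  refine (hF.comp_hasDerivAt (f := fun s => (a s, b s)) t (ha.prodMk hb)).congr_deriv ?_
  have hvec : ((a', b') : ℝ × ℝ) = a' • (1, 0) + b' • (0, 1) := by simp
  rw [hfst, hsnd, hvec, map_add, map_smul, map_smul, smul_eq_mul, smul_eq_mul]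

theorem contDiffAt_slice {w : ℝ → ℝ → ℝ}
    (hw : ContDiffOn ℝ 2 (fun p : ℝ × ℝ => w p.1 p.2) {p : ℝ × ℝ | p.2 ≠ 0})
    (s : ℝ) {p : ℝ} (hp : p ≠ 0) : ContDiffAt ℝ 2 (w s) p :=
  (hw.contDiffAt (isOpen_snd_ne_zero.mem_nhds (x := (s, p)) hp)).comp
    (f := fun y : ℝ => (s, y)) p (by fun_prop)

theorem hasDerivAt_gaussian_space (γ D x : ℝ) :
    HasDerivAt (fun y => Real.exp (-γ * y ^ 2 / (4 * D)))
      (-γ * x / (2 * D) * Real.exp (-γ * x ^ 2 / (4 * D))) x := by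
  have hpow : HasDerivAt (fun y => -γ * y ^ 2 / (4 * D)) (-γ * (2 * x) / (4 * D)) x := by
    simpa using ((hasDerivAt_pow 2 x).const_mul (-γ)).div_const (4 * D)
  refine hpow.exp.congr_deriv ?_
  rw [mul_comm]
  congr 1
  ring

theorem contDiffOn_sol17 (α β γ δ σ : ℝ) {w : ℝ → ℝ → ℝ}
    (hw : ContDiffOn ℝ 2 (fun p : ℝ × ℝ => w p.1 p.2) {p : ℝ × ℝ | p.2 ≠ 0}) :
    ContDiffOn ℝ 2 (fun q : ℝ × ℝ => sol17 α β γ δ σ w q.1 q.2)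
      {q : ℝ × ℝ | γ * q.1 + δ ≠ 0 ∧ q.2 ≠ 0} := by
  rintro ⟨t, x⟩ ⟨hD, hx⟩
  apply ContDiffAt.contDiffWithinAt
  have hlin : ContDiffAt ℝ 2 (fun q : ℝ × ℝ => γ * q.1 + δ) (t, x) := by fun_prop
  have habs : ContDiffAt ℝ 2 (fun q : ℝ × ℝ => |γ * q.1 + δ|) (t, x) := hlin.abs hD
  have hA : ContDiffAt ℝ 2 (fun q : ℝ × ℝ => |γ * q.1 + δ| ^ (-(1 : ℝ) / 2)) (t, x) :=
    habs.rpow_const_of_ne (abs_ne_zero.mpr hD)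
  have hE : ContDiffAt ℝ 2
      (fun q : ℝ × ℝ => Real.exp (-γ * q.2 ^ 2 / (4 * (γ * q.1 + δ)))) (t, x) :=
    ContDiffAt.exp (ContDiffAt.div (f := fun q : ℝ × ℝ => -γ * q.2 ^ 2)
      (g := fun q : ℝ × ℝ => 4 * (γ * q.1 + δ)) (by fun_prop) (by fun_prop)
      (mul_ne_zero four_ne_zero hD))
  have hP : ContDiffAt ℝ 2
      (fun q : ℝ × ℝ => ((α * q.1 + β) / (γ * q.1 + δ), q.2 / (γ * q.1 + δ))) (t, x) :=
    (ContDiffAt.div (by fun_prop) hlin hD).prodMk (ContDiffAt.div (by fun_prop) hlin hD)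
  have hW := (hw.contDiffAt (isOpen_snd_ne_zero.mem_nhds
    (x := ((α * t + β) / (γ * t + δ), x / (γ * t + δ))) (div_ne_zero hx hD))).comp (t, x) hP
  exact ((contDiffAt_const.mul hA).mul hE).mul hW

theorem hT_sol17 (α β γ δ σ : ℝ) (hdet : α * δ - β * γ = 1) {w : ℝ → ℝ → ℝ}
    (hw : ContDiffOn ℝ 2 (fun p : ℝ × ℝ => w p.1 p.2) {p : ℝ × ℝ | p.2 ≠ 0})
    {t x : ℝ} (hD : γ * t + δ ≠ 0) (hx : x ≠ 0) :
    hT (sol17 α β γ δ σ w) t x =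
      σ * |γ * t + δ| ^ (-(1 : ℝ) / 2) * Real.exp (-γ * x ^ 2 / (4 * (γ * t + δ))) *
        ((-γ / (2 * (γ * t + δ)) + γ ^ 2 * x ^ 2 / (4 * (γ * t + δ) ^ 2)) *
            w ((α * t + β) / (γ * t + δ)) (x / (γ * t + δ)) +
          (hT w ((α * t + β) / (γ * t + δ)) (x / (γ * t + δ)) -
            γ * x * deriv (w ((α * t + β) / (γ * t + δ))) (x / (γ * t + δ))) /
              (γ * t + δ) ^ 2) := by
  have hlin : HasDerivAt (fun s => γ * s + δ) γ t := by
    simpa using ((hasDerivAt_id t).const_mul γ).add_const δ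
  have hnum : HasDerivAt (fun s => α * s + β) α t := by
    simpa using ((hasDerivAt_id t).const_mul α).add_const β
  have hA := hasDerivAt_abs_affine_rpow γ δ t (-(1 : ℝ) / 2) hD
  have hE := ((hasDerivAt_const t (-γ * x ^ 2)).fun_div (hlin.const_mul 4)
    (mul_ne_zero four_ne_zero hD)).exp
  have hW := hasDerivAt_comp_curve (w := w) (a := fun s => (α * s + β) / (γ * s + δ))
    (b := fun s => x / (γ * s + δ))
    (((hw.contDiffAt (isOpen_snd_ne_zero.mem_nhds
      (x := ((α * t + β) / (γ * t + δ), x / (γ * t + δ))) (div_ne_zero hx hD))).differentiableAt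
        two_ne_zero))
    (hnum.fun_div hlin hD) ((hasDerivAt_const t x).fun_div hlin hD)
  have hαβ : α * (γ * t + δ) - (α * t + β) * γ = 1 := by linear_combination hdet
  refine (((hA.const_mul σ).mul hE).mul hW).deriv.trans ?_
  rw [hαβ]
  simp only [Pi.mul_apply]
  field_simp
  ring

theorem deriv_sol17 (α β γ δ σ : ℝ) {w : ℝ → ℝ → ℝ}
    (hw : ContDiffOn ℝ 2 (fun p : ℝ × ℝ => w p.1 p.2) {p : ℝ × ℝ | p.2 ≠ 0})
    {t x : ℝ} (hD : γ * t + δ ≠ 0) (hx : x ≠ 0) :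
    deriv (sol17 α β γ δ σ w t) x =
      σ * |γ * t + δ| ^ (-(1 : ℝ) / 2) * Real.exp (-γ * x ^ 2 / (4 * (γ * t + δ))) *
        (-γ * x / (2 * (γ * t + δ)) * w ((α * t + β) / (γ * t + δ)) (x / (γ * t + δ)) +
          deriv (w ((α * t + β) / (γ * t + δ))) (x / (γ * t + δ)) / (γ * t + δ)) := by
  have hE := hasDerivAt_gaussian_space γ (γ * t + δ) x
  have hW := ((contDiffAt_slice hw ((α * t + β) / (γ * t + δ))
    (div_ne_zero hx hD)).differentiableAt two_ne_zero).hasDerivAt.comp x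
      ((hasDerivAt_id x).div_const (γ * t + δ))
  refine ((hE.const_mul (σ * |γ * t + δ| ^ (-(1 : ℝ) / 2))).mul hW).deriv.trans ?_
  simp only [Function.comp_apply, id]
  ring

theorem hXX_sol17 (α β γ δ σ : ℝ) {w : ℝ → ℝ → ℝ}
    (hw : ContDiffOn ℝ 2 (fun p : ℝ × ℝ => w p.1 p.2) {p : ℝ × ℝ | p.2 ≠ 0})
    {t x : ℝ} (hD : γ * t + δ ≠ 0) (hx : x ≠ 0) :
    hXX (sol17 α β γ δ σ w) t x =
      σ * |γ * t + δ| ^ (-(1 : ℝ) / 2) * Real.exp (-γ * x ^ 2 / (4 * (γ * t + δ))) *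
        ((-γ / (2 * (γ * t + δ)) + γ ^ 2 * x ^ 2 / (4 * (γ * t + δ) ^ 2)) *
            w ((α * t + β) / (γ * t + δ)) (x / (γ * t + δ)) +
          (hXX w ((α * t + β) / (γ * t + δ)) (x / (γ * t + δ)) -
            γ * x * deriv (w ((α * t + β) / (γ * t + δ))) (x / (γ * t + δ))) /
              (γ * t + δ) ^ 2) := by
  have hev := (eventually_ne_nhds hx).mono fun y hy => deriv_sol17 α β γ δ σ hw hD hy
  have hE := hasDerivAt_gaussian_space γ (γ * t + δ) x
  have hS := contDiffAt_slice hw ((α * t + β) / (γ * t + δ)) (div_ne_zero hx hD)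
  have hscale := (hasDerivAt_id x).div_const (γ * t + δ)
  have hW := (hS.differentiableAt two_ne_zero).hasDerivAt.comp x hscale
  have hS' : DifferentiableAt ℝ (deriv (w ((α * t + β) / (γ * t + δ)))) (x / (γ * t + δ)) :=
    ((hS.fderiv_right (m := 1) one_add_one_eq_two.le).differentiableAt one_ne_zero).clm_apply
      (differentiableAt_const 1)
  have hW' := hS'.hasDerivAt.comp x hscale
  have hcoef := ((hasDerivAt_id x).const_mul (-γ)).div_const (2 * (γ * t + δ))
  refine (Filter.EventuallyEq.deriv_eq hev).trans ?_
  refine ((hE.const_mul (σ * |γ * t + δ| ^ (-(1 : ℝ) / 2))).mul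
    ((hcoef.mul hW).add (hW'.div_const (γ * t + δ)))).deriv.trans ?_
  simp only [Function.comp_apply, Pi.mul_apply, Pi.add_apply, id, hXX]
  field_simp
  ring

theorem point_symmetry_heat_inverse_square_potential
    (μ : ℝ) (hμ : μ ≠ 0) (α β γ δ σ : ℝ)
    (hdet : α * δ - β * γ = 1) (hσ : σ ≠ 0)
    (w : ℝ → ℝ → ℝ)
    (hw : ContDiffOn ℝ 2 (fun p : ℝ × ℝ => w p.1 p.2) {p : ℝ × ℝ | p.2 ≠ 0})
    (hwsol : ∀ s p : ℝ, p ≠ 0 →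
      hT w s p = hXX w s p + μ * p ^ (-(2 : ℤ)) * w s p) :
    ContDiffOn ℝ 2 (fun q : ℝ × ℝ => sol17 α β γ δ σ w q.1 q.2)
      {q : ℝ × ℝ | γ * q.1 + δ ≠ 0 ∧ q.2 ≠ 0} ∧
    ∀ t x : ℝ, γ * t + δ ≠ 0 → x ≠ 0 →
      hT (sol17 α β γ δ σ w) t x
        = hXX (sol17 α β γ δ σ w) t x
          + μ * x ^ (-(2 : ℤ)) * sol17 α β γ δ σ w t x := by
  refine ⟨contDiffOn_sol17 α β γ δ σ hw, fun t x hD hx => ?_⟩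
  rw [hT_sol17 α β γ δ σ hdet hw hD hx, hXX_sol17 α β γ δ σ hw hD hx,
    hwsol _ _ (div_ne_zero hx hD), sol17]
  simp only [zpow_neg, zpow_ofNat]
  field_simp
  ring
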